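/- Let V ⊆ B(H₁,H₂) (resp. U ⊆ B(K₁,K₂)) be a weak* closed subspace and φ (resp. ψ) be a weak* continuous completely bounded linear map on B(H₁,H₂) (resp. B(K₁,K₂)). Then (φ⊗ψ)(F(V,U)) ⊆ F(cl(φ(V)), cl(ψ(U))), where cl denotes weak* closure and φ⊗ψ is the induced weak* continuous completely bounded map on B(H₁,H₂) ⊗̄ B(K₁,K₂). Moreover, if φ and ψ are idempotents that leave V and U, respectively, invariant, then (φ⊗ψ)(F(V,U)) = F(φ(V), ψ(U)). -/

import Mathlib

open scoped ComplexInnerProductSpace Pointwise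
open Set MeasureTheory

noncomputable section

namespace OpSynth

/-! ### The σ-weak (weak*) topology on `B(H,K)` -/

/-- The σ-weak (weak*) topology on the space of bounded operators between Hilbert
spaces: the initial topology with respect to the functionals
`T ↦ ∑' n, ⟪η n, T (ξ n)⟫` associated to square-summable sequences `ξ`, `η`.
This is the weak* topology arising from the identification of `B(H,K)` with the
dual of the trace class operators. -/
def sigmaWeak (H K : Type*) [NormedAddCommGroup H] [InnerProductSpace ℂ H]
    [NormedAddCommGroup K] [InnerProductSpace ℂ K] :
    TopologicalSpace (H →L[ℂ] K) :=
  ⨅ (ξ : ℕ → H) (η : ℕ → K) (_ : Summable fun n => ‖ξ n‖ ^ 2)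
    (_ : Summable fun n => ‖η n‖ ^ 2),
    TopologicalSpace.induced
      (fun T : H →L[ℂ] K => ∑' n, ⟪η n, T (ξ n)⟫) inferInstance

section Basic

variable {H K H₁ H₂ H₃ K₁ K₂ T₁ T₂ : Type*}
  [NormedAddCommGroup H] [InnerProductSpace ℂ H]
  [NormedAddCommGroup K] [InnerProductSpace ℂ K]
  [NormedAddCommGroup H₁] [InnerProductSpace ℂ H₁]
  [NormedAddCommGroup H₂] [InnerProductSpace ℂ H₂]
  [NormedAddCommGroup H₃] [InnerProductSpace ℂ H₃]
  [NormedAddCommGroup K₁] [InnerProductSpace ℂ K₁]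
  [NormedAddCommGroup K₂] [InnerProductSpace ℂ K₂]
  [NormedAddCommGroup T₁] [InnerProductSpace ℂ T₁]
  [NormedAddCommGroup T₂] [InnerProductSpace ℂ T₂]

/-- A set of operators is weak* closed if it is closed in the σ-weak topology. -/
def WkClosed (S : Set (H →L[ℂ] K)) : Prop :=
  @IsClosed _ (sigmaWeak H K) S

/-- The weak* closure of a set of operators. -/
def wkClosure (S : Set (H →L[ℂ] K)) : Set (H →L[ℂ] K) :=
  @closure _ (sigmaWeak H K) S

/-- A weak* closed (linear) subspace of `B(H,K)`. -/
def IsWkClosedSubspace (S : Set (H →L[ℂ] K)) : Prop :=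
  (∃ M : Submodule ℂ (H →L[ℂ] K), (M : Set (H →L[ℂ] K)) = S) ∧ WkClosed S

/-- A map between operator spaces is weak* continuous if it is continuous with
respect to the σ-weak topologies. -/
def WkContinuous (φ : (H₁ →L[ℂ] H₂) → (K₁ →L[ℂ] K₂)) : Prop :=
  @Continuous _ _ (sigmaWeak H₁ H₂) (sigmaWeak K₁ K₂) φ

/-- The norm of an `n × n` matrix of operators, viewed as an operator on the
column Hilbert space `ℓ²(Fin n, H)`: the supremum over the unit ball of the
ℓ²-norm of the image. -/
def blockNorm {n : ℕ} (M : Matrix (Fin n) (Fin n) (H →L[ℂ] K)) : ℝ :=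
  sSup { r | ∃ v : Fin n → H, (∑ j, ‖v j‖ ^ 2) ≤ 1 ∧
    r = Real.sqrt (∑ i, ‖∑ j, M i j (v j)‖ ^ 2) }

/-- A map `φ : B(H₁,H₂) → B(K₁,K₂)` is completely bounded if its matrix
amplifications are uniformly bounded. -/
def CompletelyBounded (φ : (H₁ →L[ℂ] H₂) → (K₁ →L[ℂ] K₂)) : Prop :=
  ∃ C : ℝ, 0 ≤ C ∧ ∀ (n : ℕ) (M : Matrix (Fin n) (Fin n) (H₁ →L[ℂ] H₂)),
    blockNorm (M.map φ) ≤ C * blockNorm M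

/-- `t : H → K → T₁` realizes `T₁` as the Hilbertian tensor product `H ⊗ K`:
`t` is bilinear, multiplicative for inner products, and has total range. -/
def IsTensorEmbedding (t : H → K → T₁) : Prop :=
  (∀ x x' y, t (x + x') y = t x y + t x' y) ∧
  (∀ x y y', t x (y + y') = t x y + t x y') ∧
  (∀ (c : ℂ) x y, t (c • x) y = c • t x y) ∧
  (∀ (c : ℂ) x y, t x (c • y) = c • t x y) ∧
  (∀ x x' y y', ⟪t x y, t x' y'⟫ = ⟪x, x'⟫ * ⟪y, y'⟫) ∧
  (Submodule.span ℂ { z | ∃ x y, z = t x y }).topologicalClosure = ⊤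

/-- `W` is the elementary tensor `S ⊗ R` of the operators `S` and `R`, relative
to the tensor product realizations `t₁`, `t₂`. -/
def IsElemTensor (t₁ : H₁ → K₁ → T₁) (t₂ : H₂ → K₂ → T₂)
    (W : T₁ →L[ℂ] T₂) (S : H₁ →L[ℂ] H₂) (R : K₁ →L[ℂ] K₂) : Prop :=
  ∀ x y, W (t₁ x y) = t₂ (S x) (R y)

/-- The weak* closed tensor product `V ⊗̄ U`: the weak* closed subspace generated
by the elementary tensors `S ⊗ R` with `S ∈ V`, `R ∈ U`. -/
def wTensor (t₁ : H₁ → K₁ → T₁) (t₂ : H₂ → K₂ → T₂)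
    (V : Set (H₁ →L[ℂ] H₂)) (U : Set (K₁ →L[ℂ] K₂)) : Set (T₁ →L[ℂ] T₂) :=
  wkClosure ↑(Submodule.span ℂ
    { W : T₁ →L[ℂ] T₂ | ∃ S ∈ V, ∃ R ∈ U, IsElemTensor t₁ t₂ W S R })

/-- The Fubini product `F(V,U) = (V ⊗̄ B(K₁,K₂)) ∩ (B(H₁,H₂) ⊗̄ U)`. -/
def Fubini (t₁ : H₁ → K₁ → T₁) (t₂ : H₂ → K₂ → T₂)
    (V : Set (H₁ →L[ℂ] H₂)) (U : Set (K₁ →L[ℂ] K₂)) : Set (T₁ →L[ℂ] T₂) :=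
  wTensor t₁ t₂ V univ ∩ wTensor t₁ t₂ univ U

/-- Sum of finitely many subsets of an additive monoid. -/
def setSum {α : Type*} [AddCommMonoid α] {n : ℕ} (S : Fin n → Set α) : Set α :=
  { x | ∃ f : Fin n → α, (∀ i, f i ∈ S i) ∧ x = ∑ i, f i }

/-- The reflexive hull `Ref W = {T : Tx ∈ closure (W x) for all x}`. -/
def RefHull (W : Set (H →L[ℂ] K)) : Set (H →L[ℂ] K) :=
  { T | ∀ x : H, T x ∈ closure ((fun S : H →L[ℂ] K => S x) '' W) }

end Basic

/-- Property `S_σ`: `F(V,U) = V ⊗̄ U` for every weak* closed subspace `U` of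
`B(K₁,K₂)`, all Hilbert spaces `K₁`, `K₂`, and all realizations of the
corresponding Hilbertian tensor products. -/
def HasSsigma {H₁ H₂ : Type*}
    [NormedAddCommGroup H₁] [InnerProductSpace ℂ H₁]
    [NormedAddCommGroup H₂] [InnerProductSpace ℂ H₂]
    (V : Set (H₁ →L[ℂ] H₂)) : Prop :=
  ∀ (K₁ K₂ T₁ T₂ : Type)
    [NormedAddCommGroup K₁] [InnerProductSpace ℂ K₁] [CompleteSpace K₁]
    [NormedAddCommGroup K₂] [InnerProductSpace ℂ K₂] [CompleteSpace K₂]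
    [NormedAddCommGroup T₁] [InnerProductSpace ℂ T₁] [CompleteSpace T₁]
    [NormedAddCommGroup T₂] [InnerProductSpace ℂ T₂] [CompleteSpace T₂]
    (t₁ : H₁ → K₁ → T₁) (t₂ : H₂ → K₂ → T₂),
    IsTensorEmbedding t₁ → IsTensorEmbedding t₂ →
    ∀ U : Set (K₁ →L[ℂ] K₂), IsWkClosedSubspace U →
      Fubini t₁ t₂ V U = wTensor t₁ t₂ V U

section Masa

variable {H H₁ H₂ H₃ : Type*}
  [NormedAddCommGroup H] [InnerProductSpace ℂ H] [CompleteSpace H]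
  [NormedAddCommGroup H₁] [InnerProductSpace ℂ H₁] [CompleteSpace H₁]
  [NormedAddCommGroup H₂] [InnerProductSpace ℂ H₂] [CompleteSpace H₂]
  [NormedAddCommGroup H₃] [InnerProductSpace ℂ H₃] [CompleteSpace H₃]

/-- A masa: a maximal abelian selfadjoint subalgebra of `B(H)`. -/
def IsMasa (D : StarSubalgebra ℂ (H →L[ℂ] H)) : Prop :=
  (∀ a ∈ D, ∀ b ∈ D, a * b = b * a) ∧
  ∀ E : StarSubalgebra ℂ (H →L[ℂ] H),
    (∀ a ∈ E, ∀ b ∈ E, a * b = b * a) → D ≤ E → E = D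

/-- A (weak* closed) `D₂,D₁`-masa-bimodule. -/
def IsMasaBimodule (D₁ : StarSubalgebra ℂ (H₁ →L[ℂ] H₁))
    (D₂ : StarSubalgebra ℂ (H₂ →L[ℂ] H₂)) (V : Set (H₁ →L[ℂ] H₂)) : Prop :=
  IsWkClosedSubspace V ∧
  ∀ X ∈ V, ∀ A ∈ D₁, ∀ B ∈ D₂, B ∘L X ∘L A ∈ V

/-- A ternary set of operators: closed under the triple product `T S* R`. -/
def IsTernary (M : Set (H₁ →L[ℂ] H₂)) : Prop :=
  ∀ T ∈ M, ∀ S ∈ M, ∀ R ∈ M, T ∘L (ContinuousLinearMap.adjoint S) ∘L R ∈ M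

/-- An orthogonal projection. -/
def IsProj (p : H →L[ℂ] H) : Prop := p ∘L p = p ∧ IsSelfAdjoint p

/-- A minimal non-zero projection of a masa. -/
def IsMinimalProjOf (D : StarSubalgebra ℂ (H →L[ℂ] H)) (p : H →L[ℂ] H) : Prop :=
  p ∈ D ∧ IsProj p ∧ p ≠ 0 ∧
    ∀ q ∈ D, IsProj q → p ∘L q = q → q = 0 ∨ q = p

/-- A projection in a masa is non-atomic if it dominates no minimal non-zero
projection of the masa. -/
def IsNonAtomicProj (D : StarSubalgebra ℂ (H →L[ℂ] H)) (E : H →L[ℂ] H) : Prop :=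
  ∀ p, IsMinimalProjOf D p → ¬ (E ∘L p = p)

/-- A `D₂,D₁`-masa-bimodule map. -/
def IsMasaBimoduleMap (D₁ : StarSubalgebra ℂ (H₁ →L[ℂ] H₁))
    (D₂ : StarSubalgebra ℂ (H₂ →L[ℂ] H₂))
    (φ : (H₁ →L[ℂ] H₂) → (H₁ →L[ℂ] H₂)) : Prop :=
  ∀ (X : H₁ →L[ℂ] H₂), ∀ A ∈ D₁, ∀ B ∈ D₂,
    φ (B ∘L X ∘L A) = B ∘L (φ X) ∘L A

/-- A Schur idempotent: a weak* continuous completely bounded idempotent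
masa-bimodule map. -/
def IsSchurIdempotent (D₁ : StarSubalgebra ℂ (H₁ →L[ℂ] H₁))
    (D₂ : StarSubalgebra ℂ (H₂ →L[ℂ] H₂))
    (φ : (H₁ →L[ℂ] H₂) → (H₁ →L[ℂ] H₂)) : Prop :=
  IsLinearMap ℂ φ ∧ WkContinuous φ ∧ CompletelyBounded φ ∧ φ ∘ φ = φ ∧
    IsMasaBimoduleMap D₁ D₂ φ

/-- A nest: a totally ordered family of closed subspaces containing the
intersection and the closed linear span of any of its subsets. -/
def IsNest (N : Set (Submodule ℂ H)) : Prop :=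
  (∀ p ∈ N, IsClosed (p : Set H)) ∧ IsChain (· ≤ ·) N ∧
  ∀ S : Set (Submodule ℂ H), S ⊆ N →
    sInf S ∈ N ∧ (sSup S).topologicalClosure ∈ N

/-- The nest algebra of a nest: all operators leaving each subspace invariant. -/
def nestAlg (N : Set (Submodule ℂ H)) : Set (H →L[ℂ] H) :=
  { T | ∀ p ∈ N, ∀ x ∈ p, T x ∈ p }

/-- A (weak* closed) nest algebra bimodule. -/
def IsNestBimodule (V : Set (H₁ →L[ℂ] H₂)) : Prop :=
  IsWkClosedSubspace V ∧
  ∃ (N₁ : Set (Submodule ℂ H₁)) (N₂ : Set (Submodule ℂ H₂)),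
    IsNest N₁ ∧ IsNest N₂ ∧
    ∀ X ∈ V, ∀ A ∈ nestAlg N₁, ∀ B ∈ nestAlg N₂, B ∘L X ∘L A ∈ V

/-- A masa-bimodule of finite width: a finite intersection of masa-bimodules
each of which is a nest algebra bimodule. -/
def HasFiniteWidth (D₁ : StarSubalgebra ℂ (H₁ →L[ℂ] H₁))
    (D₂ : StarSubalgebra ℂ (H₂ →L[ℂ] H₂)) (V : Set (H₁ →L[ℂ] H₂)) : Prop :=
  ∃ (k : ℕ) (Vs : Fin k → Set (H₁ →L[ℂ] H₂)),
    (∀ j, IsMasaBimodule D₁ D₂ (Vs j) ∧ IsNestBimodule (Vs j)) ∧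
    V = ⋂ j, Vs j

end Masa

section Algebras

variable {H H₁ H₂ H₃ K : Type*}
  [NormedAddCommGroup H] [InnerProductSpace ℂ H] [CompleteSpace H]
  [NormedAddCommGroup H₁] [InnerProductSpace ℂ H₁] [CompleteSpace H₁]
  [NormedAddCommGroup H₂] [InnerProductSpace ℂ H₂] [CompleteSpace H₂]
  [NormedAddCommGroup H₃] [InnerProductSpace ℂ H₃] [CompleteSpace H₃]

/-- A weak* closed unital operator algebra in `B(H)`. -/
def IsWkClosedUnitalAlg (A : Set (H →L[ℂ] H)) : Prop :=
  IsWkClosedSubspace A ∧ (1 : H →L[ℂ] H) ∈ A ∧ ∀ a ∈ A, ∀ b ∈ A, a ∘L b ∈ A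

/-- `[X Y]`: the weak* closed linear span of the products `x ∘ y`. -/
def mulSpan (X : Set (H₂ →L[ℂ] H₃)) (Y : Set (H₁ →L[ℂ] H₂)) :
    Set (H₁ →L[ℂ] H₃) :=
  wkClosure ↑(Submodule.span ℂ { T : H₁ →L[ℂ] H₃ | ∃ x ∈ X, ∃ y ∈ Y, T = x ∘L y })

/-- The data witnessing a spatial embedding of `A` into `B`. -/
def SpatialPair (A : Set (H₁ →L[ℂ] H₁)) (B : Set (H₂ →L[ℂ] H₂))
    (X : Set (H₁ →L[ℂ] H₂)) (Y : Set (H₂ →L[ℂ] H₁)) : Prop :=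
  IsWkClosedSubspace X ∧ IsWkClosedSubspace Y ∧
  (∀ x ∈ X, ∀ b ∈ B, ∀ a ∈ A, b ∘L x ∘L a ∈ X) ∧
  (∀ y ∈ Y, ∀ a ∈ A, ∀ b ∈ B, a ∘L y ∘L b ∈ Y) ∧
  mulSpan X Y ⊆ B ∧ mulSpan Y X = A

/-- `A` is spatially embedded in `B`. -/
def SpatiallyEmbedded (A : Set (H₁ →L[ℂ] H₁)) (B : Set (H₂ →L[ℂ] H₂)) : Prop :=
  ∃ X Y, SpatialPair A B X Y

/-- `A` and `B` are spatially Morita equivalent. -/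
def SpatiallyMorita (A : Set (H₁ →L[ℂ] H₁)) (B : Set (H₂ →L[ℂ] H₂)) : Prop :=
  ∃ X Y, SpatialPair A B X Y ∧ mulSpan X Y = B

/-- The strong operator topology on `B(H,K)`. -/
def sot (H K : Type*) [NormedAddCommGroup H] [InnerProductSpace ℂ H]
    [NormedAddCommGroup K] [InnerProductSpace ℂ K] :
    TopologicalSpace (H →L[ℂ] K) :=
  TopologicalSpace.induced (fun T : H →L[ℂ] K => (T : H → K)) Pi.topologicalSpace

/-- A commutative subspace lattice (CSL): a strongly closed lattice of mutually
commuting orthogonal projections containing `0` and `1`. -/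
def IsCSL (L : Set (H →L[ℂ] H)) : Prop :=
  (∀ P ∈ L, IsProj P) ∧
  (∀ P ∈ L, ∀ Q ∈ L, P ∘L Q = Q ∘L P) ∧
  (0 : H →L[ℂ] H) ∈ L ∧ (1 : H →L[ℂ] H) ∈ L ∧
  (∀ P ∈ L, ∀ Q ∈ L, P ∘L Q ∈ L ∧ P + Q - P ∘L Q ∈ L) ∧
  @IsClosed _ (sot H H) L

/-- The CSL algebra `Alg L = {T : (1 - P) T P = 0 for all P ∈ L}`. -/
def cslAlg (L : Set (H →L[ℂ] H)) : Set (H →L[ℂ] H) :=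
  { T | ∀ P ∈ L, (1 - P) ∘L T ∘L P = 0 }

/-- A lattice homomorphism between CSLs (preserving meets and joins). -/
def IsLatticeHom (L₁ : Set (H₁ →L[ℂ] H₁)) (L₂ : Set (H₂ →L[ℂ] H₂))
    (φ : (H₁ →L[ℂ] H₁) → (H₂ →L[ℂ] H₂)) : Prop :=
  MapsTo φ L₁ L₂ ∧
  (∀ P ∈ L₁, ∀ Q ∈ L₁, φ (P ∘L Q) = φ P ∘L φ Q) ∧
  (∀ P ∈ L₁, ∀ Q ∈ L₁, φ (P + Q - P ∘L Q) = φ P + φ Q - φ P ∘L φ Q)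

end Algebras

section MeasurePart

variable {X X₁ X₂ : Type*} [MeasurableSpace X] [MeasurableSpace X₁] [MeasurableSpace X₂]

/-- A subset of a product of measure spaces is marginally null if it is
contained in `(M₁ × X₂) ∪ (X₁ × M₂)` with `μ₁ M₁ = μ₂ M₂ = 0`. -/
def MargNull (μ₁ : Measure X₁) (μ₂ : Measure X₂) (E : Set (X₁ × X₂)) : Prop :=
  ∃ (M₁ : Set X₁) (M₂ : Set X₂), MeasurableSet M₁ ∧ MeasurableSet M₂ ∧
    μ₁ M₁ = 0 ∧ μ₂ M₂ = 0 ∧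
    E ⊆ (M₁ ×ˢ (univ : Set X₂)) ∪ ((univ : Set X₁) ×ˢ M₂)

/-- Marginal equivalence: the symmetric difference is marginally null. -/
def MargEquiv (μ₁ : Measure X₁) (μ₂ : Measure X₂) (E F : Set (X₁ × X₂)) : Prop :=
  MargNull μ₁ μ₂ ((E \ F) ∪ (F \ E))

/-- ω-open sets: marginally equivalent to a countable union of measurable
rectangles. -/
def OmegaOpen (μ₁ : Measure X₁) (μ₂ : Measure X₂) (E : Set (X₁ × X₂)) : Prop :=
  ∃ (α : ℕ → Set X₁) (β : ℕ → Set X₂),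
    (∀ n, MeasurableSet (α n)) ∧ (∀ n, MeasurableSet (β n)) ∧
    MargEquiv μ₁ μ₂ E (⋃ n, (α n) ×ˢ (β n))

/-- ω-closed sets: complements of ω-open sets. -/
def OmegaClosed (μ₁ : Measure X₁) (μ₂ : Measure X₂) (E : Set (X₁ × X₂)) : Prop :=
  OmegaOpen μ₁ μ₂ Eᶜ

/-- `A` is a multiplication operator on `L²(X,μ)`: `A f = φ · f` for some
essentially bounded function `φ`.  The collection `{A | IsMultOp μ A}` is the
multiplication masa of `L^∞(X,μ)`. -/
def IsMultOp (μ : Measure X) (A : Lp ℂ 2 μ →L[ℂ] Lp ℂ 2 μ) : Prop :=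
  ∃ φ : X → ℂ, AEStronglyMeasurable φ μ ∧ (∃ C, ∀ᵐ x ∂μ, ‖φ x‖ ≤ C) ∧
    ∀ f : Lp ℂ 2 μ, ⇑(A f) =ᵐ[μ] fun x => φ x * f x

/-- A (weak* closed) masa-bimodule over the multiplication masas. -/
def IsMultBimodule (μ₁ : Measure X₁) (μ₂ : Measure X₂)
    (V : Set (Lp ℂ 2 μ₁ →L[ℂ] Lp ℂ 2 μ₂)) : Prop :=
  IsWkClosedSubspace V ∧
  ∀ X ∈ V, ∀ (A : Lp ℂ 2 μ₁ →L[ℂ] Lp ℂ 2 μ₁) (B : Lp ℂ 2 μ₂ →L[ℂ] Lp ℂ 2 μ₂),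
    IsMultOp μ₁ A → IsMultOp μ₂ B → B ∘L X ∘L A ∈ V

/-- `T` is supported on `κ`: `M_{χ_β} T M_{χ_α} = 0` (equivalently,
`⟪T f, g⟫ = 0` whenever `f` vanishes off `α` and `g` vanishes off `β`)
whenever the rectangle `α × β` intersects `κ` marginally nullly. -/
def SupportedOn (μ₁ : Measure X₁) (μ₂ : Measure X₂) (κ : Set (X₁ × X₂))
    (T : Lp ℂ 2 μ₁ →L[ℂ] Lp ℂ 2 μ₂) : Prop :=
  ∀ (α : Set X₁) (β : Set X₂), MeasurableSet α → MeasurableSet β →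
    MargNull μ₁ μ₂ ((α ×ˢ β) ∩ κ) →
    ∀ (f : Lp ℂ 2 μ₁) (g : Lp ℂ 2 μ₂),
      (∀ᵐ x ∂μ₁, x ∉ α → f x = 0) → (∀ᵐ y ∂μ₂, y ∉ β → g y = 0) →
      ⟪T f, g⟫ = (0 : ℂ)

/-- `M_max κ`: the space of all operators supported on `κ` — the largest
masa-bimodule with support `κ`. -/
def Mmax (μ₁ : Measure X₁) (μ₂ : Measure X₂) (κ : Set (X₁ × X₂)) :
    Set (Lp ℂ 2 μ₁ →L[ℂ] Lp ℂ 2 μ₂) :=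
  { T | SupportedOn μ₁ μ₂ κ T }

/-- `U` has support `κ`: `κ` is ω-closed and `Ref U = M_max κ`. -/
def HasSupport (μ₁ : Measure X₁) (μ₂ : Measure X₂)
    (U : Set (Lp ℂ 2 μ₁ →L[ℂ] Lp ℂ 2 μ₂)) (κ : Set (X₁ × X₂)) : Prop :=
  OmegaClosed μ₁ μ₂ κ ∧ RefHull U = Mmax μ₁ μ₂ κ

/-- `M_min κ`: the smallest weak* closed masa-bimodule with support `κ`,
realized as the intersection of all weak* closed masa-bimodules with support `κ`. -/
def Mmin (μ₁ : Measure X₁) (μ₂ : Measure X₂) (κ : Set (X₁ × X₂)) :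
    Set (Lp ℂ 2 μ₁ →L[ℂ] Lp ℂ 2 μ₂) :=
  ⋂₀ { U | IsMultBimodule μ₁ μ₂ U ∧ HasSupport μ₁ μ₂ U κ }

/-- `κ` is operator synthetic if it is ω-closed and `M_min κ = M_max κ`. -/
def OperatorSynthetic (μ₁ : Measure X₁) (μ₂ : Measure X₂)
    (κ : Set (X₁ × X₂)) : Prop :=
  OmegaClosed μ₁ μ₂ κ ∧ Mmin μ₁ μ₂ κ = Mmax μ₁ μ₂ κ

/-- A masa-bimodule of finite width over the multiplication masas. -/
def MultFiniteWidth (μ₁ : Measure X₁) (μ₂ : Measure X₂)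
    (V : Set (Lp ℂ 2 μ₁ →L[ℂ] Lp ℂ 2 μ₂)) : Prop :=
  ∃ (k : ℕ) (Vs : Fin k → Set (Lp ℂ 2 μ₁ →L[ℂ] Lp ℂ 2 μ₂)),
    (∀ j, IsMultBimodule μ₁ μ₂ (Vs j) ∧ IsNestBimodule (Vs j)) ∧
    V = ⋂ j, Vs j

/-- A set of finite width: the support of a masa-bimodule of finite width. -/
def FiniteWidthSet (μ₁ : Measure X₁) (μ₂ : Measure X₂)
    (κ : Set (X₁ × X₂)) : Prop :=
  ∃ V, MultFiniteWidth μ₁ μ₂ V ∧ HasSupport μ₁ μ₂ V κ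

end MeasurePart

/-- The flip `ρ : (X₁ × X₂) × (Y₁ × Y₂) → (X₁ × Y₁) × (X₂ × Y₂)`. -/
def flipProd {X₁ X₂ Y₁ Y₂ : Type*} :
    (X₁ × X₂) × (Y₁ × Y₂) → (X₁ × Y₁) × (X₂ × Y₂) :=
  fun q => ((q.1.1, q.2.1), (q.1.2, q.2.2))

end OpSynth



open scoped ComplexInnerProductSpace Pointwise
open Set OpSynth

namespace OpSynthAux

variable {H₁ H₂ K₁ K₂ T₁ T₂ H K T L : Type*}
    [NormedAddCommGroup H] [InnerProductSpace ℂ H]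
    [NormedAddCommGroup K] [InnerProductSpace ℂ K]
    [NormedAddCommGroup T] [InnerProductSpace ℂ T]
    [NormedAddCommGroup L] [InnerProductSpace ℂ L]
    [NormedAddCommGroup H₁] [InnerProductSpace ℂ H₁]
    [NormedAddCommGroup H₂] [InnerProductSpace ℂ H₂]
    [NormedAddCommGroup K₁] [InnerProductSpace ℂ K₁]
    [NormedAddCommGroup K₂] [InnerProductSpace ℂ K₂]
    [NormedAddCommGroup T₁] [InnerProductSpace ℂ T₁]
    [NormedAddCommGroup T₂] [InnerProductSpace ℂ T₂]

/-- The linear map from the algebraic tensor product. -/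
def tlin {t : H → K → T} (ht : IsTensorEmbedding t) : TensorProduct ℂ H K →ₗ[ℂ] T :=
  TensorProduct.lift (LinearMap.mk₂ ℂ t ht.1 ht.2.2.1 ht.2.1 ht.2.2.2.1)

theorem tlin_tmul {t : H → K → T} (ht : IsTensorEmbedding t) (x : H) (y : K) :
    tlin ht (x ⊗ₜ[ℂ] y) = t x y := by
  simp [tlin]

theorem tlin_inner {t : H → K → T} (ht : IsTensorEmbedding t) (x y : TensorProduct ℂ H K) :
    ⟪tlin ht x, tlin ht y⟫ = ⟪x, y⟫ := by
  induction x using TensorProduct.induction_on with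
  | zero => simp
  | add a b ha hb => simp only [map_add, inner_add_left, ha, hb]
  | tmul a b =>
    induction y using TensorProduct.induction_on with
    | zero => simp
    | add c d hc hd => simp only [map_add, inner_add_right, hc, hd]
    | tmul c d => rw [tlin_tmul, tlin_tmul, ht.2.2.2.2.1, TensorProduct.inner_tmul]

theorem tlin_norm {t : H → K → T} (ht : IsTensorEmbedding t) (x : TensorProduct ℂ H K) :
    ‖tlin ht x‖ = ‖x‖ := by
  rw [@norm_eq_sqrt_re_inner ℂ, @norm_eq_sqrt_re_inner ℂ, tlin_inner]

theorem tlin_dense {t : H → K → T} (ht : IsTensorEmbedding t) : DenseRange (tlin ht) := by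
  have h := ht.2.2.2.2.2
  rw [← Submodule.dense_iff_topologicalClosure_eq_top] at h
  refine h.mono ?_
  have : Submodule.span ℂ { z | ∃ x y, z = t x y } ≤ LinearMap.range (tlin ht) := by
    rw [Submodule.span_le]
    rintro z ⟨x, y, rfl⟩
    exact ⟨x ⊗ₜ[ℂ] y, tlin_tmul ht x y⟩
  intro z hz
  exact this hz

theorem exists_elem [CompleteSpace T₂] {t₁ : H₁ → K₁ → T₁} {t₂ : H₂ → K₂ → T₂}
    (ht₁ : IsTensorEmbedding t₁) (ht₂ : IsTensorEmbedding t₂)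
    (S : H₁ →L[ℂ] H₂) (R : K₁ →L[ℂ] K₂) :
    ∃ W : T₁ →L[ℂ] T₂, IsElemTensor t₁ t₂ W S R := by
  let f : TensorProduct ℂ H₁ K₁ →ₗ[ℂ] T₂ :=
    (tlin ht₂).comp (TensorProduct.mapL S R).toLinearMap
  refine ⟨f.extendOfNorm (tlin ht₁), fun x y => ?_⟩
  have hb : ∃ C, ∀ x, ‖f x‖ ≤ C * ‖tlin ht₁ x‖ := by
    refine ⟨‖TensorProduct.mapL S R‖, fun x => ?_⟩
    rw [tlin_norm]
    change ‖tlin ht₂ (TensorProduct.mapL S R x)‖ ≤ _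
    rw [tlin_norm]
    exact ContinuousLinearMap.le_opNorm _ _
  rw [← tlin_tmul ht₁, LinearMap.extendOfNorm_eq (tlin_dense ht₁) hb]
  change tlin ht₂ (TensorProduct.mapL S R (x ⊗ₜ[ℂ] y)) = _
  rw [TensorProduct.mapL_tmul, tlin_tmul]

theorem norm_t {t : H → K → T} (ht : IsTensorEmbedding t) (x : H) (y : K) :
    ‖t x y‖ = ‖x‖ * ‖y‖ := by
  rw [← tlin_tmul ht, tlin_norm, TensorProduct.norm_tmul]

/-- `J h : k ↦ h ⊗ k`. -/
def J {t : H → K → T} (ht : IsTensorEmbedding t) (h : H) : K →L[ℂ] T :=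
  LinearMap.mkContinuous
    { toFun := t h
      map_add' := ht.2.1 h
      map_smul' := fun c y => ht.2.2.2.1 c h y } ‖h‖ (fun y => (norm_t ht h y).le)

@[simp] theorem J_apply {t : H → K → T} (ht : IsTensorEmbedding t) (h : H) (k : K) :
    J ht h k = t h k := rfl

/-- Slice map. -/
def slice [CompleteSpace K₂] [CompleteSpace T₂] {t₁ : H₁ → K₁ → T₁} {t₂ : H₂ → K₂ → T₂}
    (ht₁ : IsTensorEmbedding t₁) (ht₂ : IsTensorEmbedding t₂) (h₁ : H₁) (h₂ : H₂)
    (X : T₁ →L[ℂ] T₂) : K₁ →L[ℂ] K₂ :=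
  (ContinuousLinearMap.adjoint (J ht₂ h₂)) ∘L X ∘L (J ht₁ h₁)

section
variable [CompleteSpace K₂] [CompleteSpace T₂] {t₁ : H₁ → K₁ → T₁} {t₂ : H₂ → K₂ → T₂}
    (ht₁ : IsTensorEmbedding t₁) (ht₂ : IsTensorEmbedding t₂) (h₁ : H₁) (h₂ : H₂)

theorem slice_inner (X : T₁ →L[ℂ] T₂) (k₁ : K₁) (k₂ : K₂) :
    ⟪k₂, slice ht₁ ht₂ h₁ h₂ X k₁⟫ = ⟪t₂ h₂ k₂, X (t₁ h₁ k₁)⟫ := by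
  simp [slice, ContinuousLinearMap.adjoint_inner_right]

theorem slice_linear : IsLinearMap ℂ (slice ht₁ ht₂ h₁ h₂) := by
  constructor
  · intro X Y; ext k; simp [slice]
  · intro c X; ext k; simp [slice]

theorem slice_elem {W : T₁ →L[ℂ] T₂} {S : H₁ →L[ℂ] H₂} {R : K₁ →L[ℂ] K₂}
    (hW : IsElemTensor t₁ t₂ W S R) :
    slice ht₁ ht₂ h₁ h₂ W = ⟪h₂, S h₁⟫ • R := by
  ext k
  refine ext_inner_left ℂ fun v => ?_
  rw [slice_inner, hW, ht₂.2.2.2.2.1]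
  simp [inner_smul_right]

theorem continuous_func (ξ : ℕ → H) (η : ℕ → K) (hξ : Summable fun n => ‖ξ n‖ ^ 2)
    (hη : Summable fun n => ‖η n‖ ^ 2) :
    @Continuous _ _ (sigmaWeak H K) _ (fun T : H →L[ℂ] K => ∑' n, ⟪η n, T (ξ n)⟫) := by
  rw [continuous_iff_le_induced]
  exact iInf_le_of_le ξ (iInf_le_of_le η (iInf_le_of_le hξ (iInf_le _ hη)))

theorem slice_wkContinuous : WkContinuous (slice ht₁ ht₂ h₁ h₂) := by
  refine continuous_iInf_rng.2 fun ξ => continuous_iInf_rng.2 fun η =>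
    continuous_iInf_rng.2 fun hξ => continuous_iInf_rng.2 fun hη => continuous_induced_rng.2 ?_
  have := continuous_func (fun n => t₁ h₁ (ξ n)) (fun n => t₂ h₂ (η n))
    (by simpa only [norm_t ht₁, mul_pow] using hξ.mul_left _)
    (by simpa only [norm_t ht₂, mul_pow] using hη.mul_left _)
  convert this using 2 with X
  simp [slice_inner]

theorem ext_slice {X Y : T₁ →L[ℂ] T₂}
    (h : ∀ h₁ h₂, slice ht₁ ht₂ h₁ h₂ X = slice ht₁ ht₂ h₁ h₂ Y) : X = Y := by
  have key : ∀ x y, ⟪tlin ht₂ x, X (tlin ht₁ y)⟫ = ⟪tlin ht₂ x, Y (tlin ht₁ y)⟫ := by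
    intro x y
    induction x using TensorProduct.induction_on with
    | zero => simp
    | add a b ha hb => simp only [map_add, inner_add_left, ha, hb]
    | tmul a b =>
      induction y using TensorProduct.induction_on with
      | zero => simp
      | add c d hc hd => simp only [map_add, inner_add_right, hc, hd]
      | tmul c d =>
        rw [tlin_tmul, tlin_tmul, ← slice_inner ht₁ ht₂, h, slice_inner]
  apply ContinuousLinearMap.coeFn_injective
  refine (tlin_dense ht₁).equalizer X.continuous Y.continuous ?_
  funext y
  refine ext_inner_left ℂ fun v => ?_
  have := (tlin_dense ht₂).equalizer (g := fun v => ⟪v, X (tlin ht₁ y)⟫)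
    (h := fun v => ⟪v, Y (tlin ht₁ y)⟫) (by fun_prop) (by fun_prop)
    (funext fun x => key x y)
  exact congrFun this v

end

theorem t2_sigmaWeak : @T2Space _ (sigmaWeak H K) := by
  letI := sigmaWeak H K
  refine T2Space.of_injective_continuous (Y := H → K → ℂ) (f := fun T x y => ⟪y, T x⟫) ?_ ?_
  · intro S T h
    ext x
    exact ext_inner_left ℂ fun v => congrFun (congrFun h x) v
  · refine continuous_pi fun x => continuous_pi fun y => ?_
    have hs : ∀ (E : Type _) [NormedAddCommGroup E] (x : E),
        Summable fun n => ‖(Pi.single 0 x : ℕ → E) n‖ ^ 2 := by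
      intro E _ x
      refine summable_of_ne_finset_zero (s := {0}) fun n hn => ?_
      have : n ≠ 0 := by simpa using hn
      simp [Pi.single_eq_of_ne this]
    have hs' : ∀ (E : Type _) [NormedAddCommGroup E] (x : E),
        Summable fun n => ‖(Pi.single 0 x : ℕ → E) n‖ ^ 2 := by
      intro E _ x
      refine summable_of_ne_finset_zero (s := {0}) fun n hn => ?_
      have : n ≠ 0 := by simpa using hn
      simp [Pi.single_eq_of_ne this]
    have := continuous_func (Pi.single 0 x : ℕ → H) (Pi.single 0 y : ℕ → K) (hs H x) (hs' K y)
    convert this using 2 with T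
    rw [tsum_eq_single 0]
    · simp
    · intro n hn
      simp [Pi.single_eq_of_ne hn]

theorem wTensor_mono {t₁ : H₁ → K₁ → T₁} {t₂ : H₂ → K₂ → T₂}
    {V V' : Set (H₁ →L[ℂ] H₂)} {U U' : Set (K₁ →L[ℂ] K₂)} (hV : V ⊆ V') (hU : U ⊆ U') :
    wTensor t₁ t₂ V U ⊆ wTensor t₁ t₂ V' U' := by
  letI := sigmaWeak T₁ T₂
  refine closure_mono ?_
  refine Submodule.span_mono ?_
  rintro W ⟨S, hS, R, hR, h⟩
  exact ⟨S, hV hS, R, hU hR, h⟩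

/-- A closed-submodule induction principle for `wTensor`. -/
theorem map_wTensor {t₁ : H₁ → K₁ → T₁} {t₂ : H₂ → K₂ → T₂}
    {V : Set (H₁ →L[ℂ] H₂)} {U : Set (K₁ →L[ℂ] K₂)}
    {f : (T₁ →L[ℂ] T₂) → (H →L[ℂ] K)} (hf : IsLinearMap ℂ f) (hfc : WkContinuous f)
    (M : Submodule ℂ (H →L[ℂ] K))
    (hM : ∀ W S R, S ∈ V → R ∈ U → IsElemTensor t₁ t₂ W S R → f W ∈ M)
    {X : T₁ →L[ℂ] T₂} (hX : X ∈ wTensor t₁ t₂ V U) : f X ∈ wkClosure (M : Set (H →L[ℂ] K)) := by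
  letI := sigmaWeak T₁ T₂
  letI := sigmaWeak H K
  have hfc' : Continuous f := hfc
  refine map_mem_closure hfc' hX ?_
  have : Submodule.span ℂ { W : T₁ →L[ℂ] T₂ | ∃ S ∈ V, ∃ R ∈ U, IsElemTensor t₁ t₂ W S R }
      ≤ M.comap hf.mk' := by
    rw [Submodule.span_le]
    rintro W ⟨S, hS, R, hR, h⟩
    exact hM W S R hS hR h
  intro W hW
  exact this hW

theorem eq_wTensor {t₁ : H₁ → K₁ → T₁} {t₂ : H₂ → K₂ → T₂}
    {V : Set (H₁ →L[ℂ] H₂)} {U : Set (K₁ →L[ℂ] K₂)}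
    {f g : (T₁ →L[ℂ] T₂) → (H →L[ℂ] K)} (hf : IsLinearMap ℂ f) (hfc : WkContinuous f)
    (hg : IsLinearMap ℂ g) (hgc : WkContinuous g)
    (hM : ∀ W S R, S ∈ V → R ∈ U → IsElemTensor t₁ t₂ W S R → f W = g W)
    {X : T₁ →L[ℂ] T₂} (hX : X ∈ wTensor t₁ t₂ V U) : f X = g X := by
  letI := sigmaWeak T₁ T₂
  letI := sigmaWeak H K
  haveI : T2Space (H →L[ℂ] K) := t2_sigmaWeak
  have hfc' : Continuous f := hfc
  have hgc' : Continuous g := hgc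
  have h1 : Submodule.span ℂ { W : T₁ →L[ℂ] T₂ | ∃ S ∈ V, ∃ R ∈ U, IsElemTensor t₁ t₂ W S R }
      ≤ LinearMap.eqLocus hf.mk' hg.mk' := by
    rw [Submodule.span_le]
    rintro W ⟨S, hS, R, hR, h⟩
    exact hM W S R hS hR h
  have h2 : IsClosed {W | f W = g W} := isClosed_eq hfc' hgc'
  exact closure_minimal (fun W hW => h1 hW) h2 hX

theorem image_closed {V : Set (H →L[ℂ] K)} (hV : IsWkClosedSubspace V)
    {φ : (H →L[ℂ] K) → (H →L[ℂ] K)} (hφwk : WkContinuous φ)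
    (hid : φ ∘ φ = φ) (hinv : φ '' V ⊆ V) : wkClosure (φ '' V) = φ '' V := by
  letI := sigmaWeak H K
  haveI : T2Space (H →L[ℂ] K) := t2_sigmaWeak
  have hc : Continuous φ := hφwk
  have hVc : IsClosed V := hV.2
  have : φ '' V = V ∩ {x | φ x = x} := by
    ext x
    constructor
    · rintro ⟨y, hy, rfl⟩
      exact ⟨hinv ⟨y, hy, rfl⟩, congrFun hid y⟩
    · rintro ⟨hx, hx'⟩
      exact ⟨x, hx, hx'⟩
  have hcl : IsClosed (φ '' V) := by
    rw [this]
    exact hVc.inter (isClosed_eq hc continuous_id)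
  exact hcl.closure_eq

end OpSynthAux

open OpSynthAux

/-- Lemma `l_invf`. -/
theorem statement1
    {H₁ H₂ K₁ K₂ T₁ T₂ : Type*}
    [NormedAddCommGroup H₁] [InnerProductSpace ℂ H₁] [CompleteSpace H₁]
    [NormedAddCommGroup H₂] [InnerProductSpace ℂ H₂] [CompleteSpace H₂]
    [NormedAddCommGroup K₁] [InnerProductSpace ℂ K₁] [CompleteSpace K₁]
    [NormedAddCommGroup K₂] [InnerProductSpace ℂ K₂] [CompleteSpace K₂]
    [NormedAddCommGroup T₁] [InnerProductSpace ℂ T₁] [CompleteSpace T₁]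
    [NormedAddCommGroup T₂] [InnerProductSpace ℂ T₂] [CompleteSpace T₂]
    (t₁ : H₁ → K₁ → T₁) (t₂ : H₂ → K₂ → T₂)
    (ht₁ : IsTensorEmbedding t₁) (ht₂ : IsTensorEmbedding t₂)
    (V : Set (H₁ →L[ℂ] H₂)) (U : Set (K₁ →L[ℂ] K₂))
    (hV : IsWkClosedSubspace V) (hU : IsWkClosedSubspace U)
    (φ : (H₁ →L[ℂ] H₂) → (H₁ →L[ℂ] H₂)) (ψ : (K₁ →L[ℂ] K₂) → (K₁ →L[ℂ] K₂))
    (hφlin : IsLinearMap ℂ φ) (hφwk : WkContinuous φ) (hφcb : CompletelyBounded φ)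
    (hψlin : IsLinearMap ℂ ψ) (hψwk : WkContinuous ψ) (hψcb : CompletelyBounded ψ)
    -- `Φ` is the induced map `φ ⊗ ψ`, characterized by its action on elementary
    -- tensors together with linearity and weak* continuity:
    (Φ : (T₁ →L[ℂ] T₂) → (T₁ →L[ℂ] T₂))
    (hΦlin : IsLinearMap ℂ Φ) (hΦwk : WkContinuous Φ)
    (hΦ : ∀ (A : H₁ →L[ℂ] H₂) (B : K₁ →L[ℂ] K₂) (W W' : T₁ →L[ℂ] T₂),
      IsElemTensor t₁ t₂ W A B → IsElemTensor t₁ t₂ W' (φ A) (ψ B) → Φ W = W') :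
    Φ '' Fubini t₁ t₂ V U ⊆
        Fubini t₁ t₂ (wkClosure (φ '' V)) (wkClosure (ψ '' U)) ∧
    (φ ∘ φ = φ → ψ ∘ ψ = ψ → φ '' V ⊆ V → ψ '' U ⊆ U →
      Φ '' Fubini t₁ t₂ V U = Fubini t₁ t₂ (φ '' V) (ψ '' U)) := by
  have hsub : ∀ {H K : Type _} [NormedAddCommGroup H] [InnerProductSpace ℂ H]
      [NormedAddCommGroup K] [InnerProductSpace ℂ K] (S : Set (H →L[ℂ] K)),
      S ⊆ wkClosure S := fun {H K} _ _ _ _ S => @subset_closure _ (sigmaWeak H K) S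
  have hsubK : ∀ {H K : Type _} [NormedAddCommGroup H] [InnerProductSpace ℂ H]
      [NormedAddCommGroup K] [InnerProductSpace ℂ K] (S : Set (H →L[ℂ] K)),
      S ⊆ wkClosure S := fun {H K} _ _ _ _ S => @subset_closure _ (sigmaWeak H K) S
  have part1 : Φ '' Fubini t₁ t₂ V U ⊆
      Fubini t₁ t₂ (wkClosure (φ '' V)) (wkClosure (ψ '' U)) := by
    rintro _ ⟨X, ⟨hX1, hX2⟩, rfl⟩
    constructor
    · refine map_wTensor hΦlin hΦwk _ ?_ hX1
      intro W S R hS hR hW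
      obtain ⟨W', hW'⟩ := exists_elem ht₁ ht₂ (φ S) (ψ R)
      rw [hΦ S R W W' hW hW']
      exact Submodule.subset_span ⟨φ S, hsub _ ⟨S, hS, rfl⟩, ψ R, trivial, hW'⟩
    · refine map_wTensor hΦlin hΦwk _ ?_ hX2
      intro W S R hS hR hW
      obtain ⟨W', hW'⟩ := exists_elem ht₁ ht₂ (φ S) (ψ R)
      rw [hΦ S R W W' hW hW']
      exact Submodule.subset_span ⟨φ S, trivial, ψ R, hsubK _ ⟨R, hR, rfl⟩, hW'⟩
  refine ⟨part1, fun hφi hψi hφV hψU => ?_⟩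
  have hVc := image_closed hV hφwk hφi hφV
  have hUc := image_closed hU hψwk hψi hψU
  refine Subset.antisymm ?_ ?_
  · rw [hVc, hUc] at part1
    exact part1
  · rintro X ⟨hX1, hX2⟩
    refine ⟨X, ⟨wTensor_mono hφV Subset.rfl hX1, wTensor_mono Subset.rfl hψU hX2⟩, ?_⟩
    refine ext_slice ht₁ ht₂ fun h₁ h₂ => ?_
    have hsl := slice_linear ht₁ ht₂ h₁ h₂
    have hsc := slice_wkContinuous ht₁ ht₂ h₁ h₂
    have e1 : slice ht₁ ht₂ h₁ h₂ (Φ X) = ψ (slice ht₁ ht₂ h₁ h₂ X) := by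
      refine eq_wTensor (f := fun X => slice ht₁ ht₂ h₁ h₂ (Φ X))
        (g := fun X => ψ (slice ht₁ ht₂ h₁ h₂ X)) ?_ ?_ ?_ ?_ ?_ hX1
      · exact (hsl.mk'.comp hΦlin.mk').isLinear
      · exact @Continuous.comp _ _ _ (sigmaWeak T₁ T₂) (sigmaWeak T₁ T₂) (sigmaWeak K₁ K₂)
          _ _ hsc hΦwk
      · exact (hψlin.mk'.comp hsl.mk').isLinear
      · exact @Continuous.comp _ _ _ (sigmaWeak T₁ T₂) (sigmaWeak K₁ K₂) (sigmaWeak K₁ K₂)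
          _ _ hψwk hsc
      · rintro W _ R ⟨S, hS, rfl⟩ hR hW
        obtain ⟨W', hW'⟩ := exists_elem ht₁ ht₂ (φ (φ S)) (ψ R)
        have hφφ : φ (φ S) = φ S := congrFun hφi S
        rw [hΦ _ _ W W' hW hW', slice_elem ht₁ ht₂ h₁ h₂ hW', slice_elem ht₁ ht₂ h₁ h₂ hW,
          hψlin.map_smul, hφφ]
    have e2 : ψ (slice ht₁ ht₂ h₁ h₂ X) = slice ht₁ ht₂ h₁ h₂ X := by
      refine eq_wTensor (f := fun X => ψ (slice ht₁ ht₂ h₁ h₂ X))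
        (g := fun X => slice ht₁ ht₂ h₁ h₂ X) ?_ ?_ hsl hsc ?_ hX2
      · exact (hψlin.mk'.comp hsl.mk').isLinear
      · exact @Continuous.comp _ _ _ (sigmaWeak T₁ T₂) (sigmaWeak K₁ K₂) (sigmaWeak K₁ K₂)
          _ _ hψwk hsc
      · rintro W S _ hS ⟨R, hR, rfl⟩ hW
        have hψψ : ψ (ψ R) = ψ R := congrFun hψi R
        rw [slice_elem ht₁ ht₂ h₁ h₂ hW, hψlin.map_smul, hψψ]
    rw [e1, e2]
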